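/- Almost maximum entropy for small connected subsystems: for every integer d ≥ 2 and every real r with 0 < r < 2, there exist constants C, C' > 0, depending only on d and r, such that for all integers D ≥ 2, l ≥ 1 and n ≥ 2·log(D)/log(d) + l, taking A := {1,…,l} to be a block of l consecutive sites, one has Pr_{ψ ∼ μ_{d,n,D}} ( Tr[(ρ'_A)²] ≥ C·D^{−r} + d^{−l} ) ≤ C'·D^{−(2−r)}. -/

import Mathlib

open MeasureTheory Matrix
open scoped ComplexConjugate

noncomputable section

instance matrixMeasurableSpace {m n : Type*} : MeasurableSpace (Matrix m n ℂ) :=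
  MeasurableSpace.pi

/-- The site tensor `A^{(m)}_i = (⟨i| ⊗ 1_D) U (|0⟩ ⊗ 1_D)`. -/
def siteMat (d D : ℕ) [NeZero d] (U : Matrix.unitaryGroup (Fin d × Fin D) ℂ) (i : Fin d) :
    Matrix (Fin D) (Fin D) ℂ :=
  Matrix.of fun a b => (U : Matrix (Fin d × Fin D) (Fin d × Fin D) ℂ) (i, a) (0, b)

/-- The (unnormalized) matrix product state `ψ`, with periodic boundary conditions:
`ψ(i₁,…,iₙ) = Tr[A^{(1)}_{i₁} ⋯ A^{(n)}_{iₙ}]`. -/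
def mps (d D n : ℕ) [NeZero d] (U : Fin n → Matrix.unitaryGroup (Fin d × Fin D) ℂ) :
    (Fin n → Fin d) → ℂ :=
  fun idx => Matrix.trace (((List.finRange n).map fun m => siteMat d D (U m) (idx m)).prod)

/-- Merge a configuration on `A` with a configuration on `Aᶜ` into a full configuration. -/
def mergeCfg {n d : ℕ} (A : Finset (Fin n)) (x : (i : A) → Fin d)
    (z : (i : (Aᶜ : Finset (Fin n))) → Fin d) : Fin n → Fin d :=
  fun i => if h : i ∈ A then x ⟨i, h⟩ else z ⟨i, Finset.mem_compl.mpr h⟩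

/-- The (unnormalized) reduced density matrix `ρ_A = Tr_{A^c}[|ψ⟩⟨ψ|]` of a vector
`ψ ∈ (ℂ^d)^{⊗n}` on the sites in `A`. -/
def rhoA {n d : ℕ} (A : Finset (Fin n)) (ψ : (Fin n → Fin d) → ℂ) :
    Matrix ((i : A) → Fin d) ((i : A) → Fin d) ℂ :=
  Matrix.of fun x y =>
    ∑ z : (i : (Aᶜ : Finset (Fin n))) → Fin d, ψ (mergeCfg A x z) * conj (ψ (mergeCfg A y z))

/-- `η(x,y) := (x y² − x)/(x² y² − 1)`. -/
def etaF (x y : ℝ) : ℝ := (x * y ^ 2 - x) / (x ^ 2 * y ^ 2 - 1)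
section moments
variable {ι : Type*} [Fintype ι] [DecidableEq ι]

lemma meas_entry (a b : ι) :
    Measurable fun U : Matrix.unitaryGroup ι ℂ => (U : Matrix ι ι ℂ) a b :=
  (measurable_pi_apply b).comp ((measurable_pi_apply a).comp measurable_subtype_coe)

lemma meas_mulLeft (V : Matrix.unitaryGroup ι ℂ) :
    Measurable fun U : Matrix.unitaryGroup ι ℂ => V * U := by
  refine Measurable.subtype_mk ?_
  refine measurable_pi_lambda _ fun a => measurable_pi_lambda _ fun b => ?_
  simp only [Matrix.mul_apply]
  exact Finset.measurable_sum _ fun c _ => (meas_entry c b).const_mul _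

lemma norm_entry (U : Matrix.unitaryGroup ι ℂ) (a b : ι) : ‖(U : Matrix ι ι ℂ) a b‖ ≤ 1 :=
  entry_norm_bound_of_unitary U.2 a b

/-- quartic monomial -/
def mon4 (a b a' b' i j i' j' : ι) (U : Matrix.unitaryGroup ι ℂ) : ℂ :=
  (U : Matrix ι ι ℂ) a i * (U : Matrix ι ι ℂ) b j *
    (conj ((U : Matrix ι ι ℂ) a' i') * conj ((U : Matrix ι ι ℂ) b' j'))

lemma meas_mon4 (a b a' b' i j i' j' : ι) : Measurable (mon4 a b a' b' i j i' j') := by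
  unfold mon4
  exact ((meas_entry _ _).mul (meas_entry _ _)).mul
    ((Complex.continuous_conj.measurable.comp (meas_entry _ _)).mul
      (Complex.continuous_conj.measurable.comp (meas_entry _ _)))

lemma norm_mon4 (a b a' b' i j i' j' : ι) (U : Matrix.unitaryGroup ι ℂ) :
    ‖mon4 a b a' b' i j i' j' U‖ ≤ 1 := by
  unfold mon4
  simp only [norm_mul, RCLike.norm_conj]
  exact mul_le_one₀ (mul_le_one₀ (norm_entry _ _ _) (norm_nonneg _) (norm_entry _ _ _))
    (by positivity) (mul_le_one₀ (norm_entry _ _ _) (norm_nonneg _) (norm_entry _ _ _))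

variable (μ : Measure (Matrix.unitaryGroup ι ℂ)) [IsProbabilityMeasure μ]

lemma int_mon4 (a b a' b' i j i' j' : ι) : Integrable (mon4 a b a' b' i j i' j') μ :=
  Integrable.of_bound (meas_mon4 _ _ _ _ _ _ _ _).aestronglyMeasurable 1
    (Filter.Eventually.of_forall fun U => norm_mon4 _ _ _ _ _ _ _ _ U)

/-- quartic moment -/
def mom4 (i j i' j' a b a' b' : ι) : ℂ := ∫ U, mon4 a b a' b' i j i' j' U ∂μ

variable (hμ : ∀ V : Matrix.unitaryGroup ι ℂ, μ.map (fun U => V * U) = μ)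

include hμ in
lemma mom4_inv (V : Matrix.unitaryGroup ι ℂ) (i j i' j' a b a' b' : ι) :
    mom4 μ i j i' j' a b a' b' = ∫ U, mon4 a b a' b' i j i' j' (V * U) ∂μ := by
  have h := integral_map (μ := μ) (φ := fun U => V * U) (meas_mulLeft V).aemeasurable
    (f := mon4 a b a' b' i j i' j') (meas_mon4 _ _ _ _ _ _ _ _).aestronglyMeasurable
  rw [hμ V] at h
  exact h

/-- phase unitary -/
def phaseU (c : ι) : Matrix.unitaryGroup ι ℂ :=
  ⟨Matrix.diagonal fun a => if a = c then Complex.I else 1, by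
    rw [Matrix.mem_unitaryGroup_iff, Matrix.star_eq_conjTranspose, Matrix.diagonal_conjTranspose,
      Matrix.diagonal_mul_diagonal, ← Matrix.diagonal_one]
    congr 1
    funext a
    by_cases h : a = c <;> simp [h]⟩

/-- permutation unitary -/
def permU (σ : Equiv.Perm ι) : Matrix.unitaryGroup ι ℂ :=
  ⟨Matrix.of fun a b => if σ a = b then 1 else 0, by
    rw [Matrix.mem_unitaryGroup_iff]
    ext a b
    simp [Matrix.mul_apply, Matrix.one_apply, Matrix.star_apply, apply_ite, eq_comm]⟩

/-- reflection vector -/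
def reflV (a b : ι) : ι → ℂ := Pi.single a 1 - Pi.single b 2

/-- reflection unitary -/
def reflU (a b : ι) (h : a ≠ b) : Matrix.unitaryGroup ι ℂ :=
  ⟨1 - (2/5 : ℂ) • Matrix.vecMulVec (reflV a b) (reflV a b),
  by
    rw [Matrix.mem_unitaryGroup_iff]
    have h0 : ∀ x, conj (reflV a b x) = reflV a b x := by
      intro x
      simp only [reflV, Pi.sub_apply, Pi.single_apply]
      split_ifs <;> simp [map_ofNat]
    have h1 : star (1 - (2/5 : ℂ) • Matrix.vecMulVec (reflV a b) (reflV a b)) =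
        1 - (2/5 : ℂ) • Matrix.vecMulVec (reflV a b) (reflV a b) := by
      ext x y
      have h25 : conj (2/5 : ℂ) = 2/5 := by simp [map_ofNat]
      simp only [Matrix.star_apply, Matrix.vecMulVec_apply, Matrix.one_apply, Matrix.sub_apply,
        Matrix.smul_apply, smul_eq_mul, star_sub, star_mul', RCLike.star_def, h0, h25,
        apply_ite conj, map_one, map_zero, eq_comm (a := y)]
      ring
    rw [h1]
    have h2 : reflV a b ⬝ᵥ reflV a b = 5 := by
      simp [reflV, sub_dotProduct, h, h.symm]; norm_num
    simp only [mul_sub, sub_mul, one_mul, mul_one, smul_mul_assoc, mul_smul_comm,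
      Matrix.vecMulVec_mul_vecMulVec, h2, Matrix.vecMulVec_smul, smul_smul]
    module⟩

lemma phaseU_mul (c : ι) (U : Matrix.unitaryGroup ι ℂ) (a i : ι) :
    ((phaseU c * U : Matrix.unitaryGroup ι ℂ) : Matrix ι ι ℂ) a i =
      (if a = c then Complex.I else 1) * (U : Matrix ι ι ℂ) a i := by
  simp [phaseU]

lemma permU_mul (σ : Equiv.Perm ι) (U : Matrix.unitaryGroup ι ℂ) (a i : ι) :
    ((permU σ * U : Matrix.unitaryGroup ι ℂ) : Matrix ι ι ℂ) a i =
      (U : Matrix ι ι ℂ) (σ a) i := by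
  simp [permU, Matrix.mul_apply]

lemma reflU_mul (a b : ι) (h : a ≠ b) (U : Matrix.unitaryGroup ι ℂ) (i : ι) :
    ((reflU a b h * U : Matrix.unitaryGroup ι ℂ) : Matrix ι ι ℂ) a i =
      (3/5) * (U : Matrix ι ι ℂ) a i + (4/5) * (U : Matrix ι ι ℂ) b i := by
  simp [reflU, reflV, sub_mul, Matrix.vecMulVec_mul, Matrix.vecMulVec_apply, Matrix.sub_vecMul, h]
  ring

include hμ in
lemma mom4_perm (σ : Equiv.Perm ι) (i j i' j' a b a' b' : ι) :
    mom4 μ i j i' j' a b a' b' = mom4 μ i j i' j' (σ a) (σ b) (σ a') (σ b') := by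
  rw [mom4_inv μ hμ (permU σ)]
  simp only [mom4, mon4, permU_mul]

include hμ in
lemma mom4_phase (c : ι) (i j i' j' a b a' b' : ι) :
    mom4 μ i j i' j' a b a' b' = ((if a = c then Complex.I else 1) * (if b = c then Complex.I else 1)
      * (conj (if a' = c then Complex.I else 1) * conj (if b' = c then Complex.I else 1))) *
      mom4 μ i j i' j' a b a' b' := by
  conv_lhs => rw [mom4_inv μ hμ (phaseU c)]
  rw [mom4, ← integral_const_mul]
  congr 1
  funext U
  simp only [mon4, phaseU_mul, map_mul]
  ring

include hμ in
lemma mom4_zero (i j i' j' a b a' b' : ι) (h1 : ¬ (a = a' ∧ b = b')) (h2 : ¬ (a = b' ∧ b = a')) :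
    mom4 μ i j i' j' a b a' b' = 0 := by
  have key : ∀ z w : ℂ, w = z * w → z ≠ 1 → w = 0 := by
    intro z w h hz
    have : (z - 1) * w = 0 := by linear_combination -h
    rcases mul_eq_zero.1 this with h | h
    · exact absurd (sub_eq_zero.1 h) hz
    · exact h
  have hI : Complex.I ≠ 1 := fun h => by simpa using congrArg Complex.im h
  have hI2 : (-1 : ℂ) ≠ 1 := by norm_num
  by_cases ha : a = a'
  · subst ha
    have hb : b' ≠ b := fun h => h1 ⟨rfl, h.symm⟩
    refine key _ _ (mom4_phase μ hμ b _ _ _ _ _ _ _ _) ?_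
    by_cases hab : a = b <;> simp [hb, hab, hI]
  · by_cases hb : a = b'
    · subst hb
      have hb : a' ≠ b := fun h => h2 ⟨rfl, h.symm⟩
      refine key _ _ (mom4_phase μ hμ b _ _ _ _ _ _ _ _) ?_
      by_cases hab : a = b <;> simp [hb, hab, hI]
    · refine key _ _ (mom4_phase μ hμ a _ _ _ _ _ _ _ _) ?_
      by_cases hab : b = a <;> simp [Ne.symm ha, Ne.symm hb, hab, hI, hI2]

lemma exists_perm (a b a' b' : ι) (h : a ≠ b) (h' : a' ≠ b') :
    ∃ σ : Equiv.Perm ι, σ a = a' ∧ σ b = b' := by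
  refine ⟨(Equiv.swap a a').trans (Equiv.swap (Equiv.swap a a' b) b'), ?_, ?_⟩
  · have : a' ≠ Equiv.swap a a' b := by
      intro h2
      apply h
      have := congrArg (Equiv.swap a a') h2
      simpa using this
    simp [Equiv.swap_apply_of_ne_of_ne this h']
  · simp

include hμ in
lemma mom4_diag (i j i' j' a b : ι) (hab : a ≠ b) :
    mom4 μ i j i' j' a a a a = mom4 μ i j i' j' a b a b + mom4 μ i j i' j' a b b a := by
  have h := mom4_inv μ hμ (reflU a b hab) i j i' j' a a a a
  let f : Bool → ι := fun t => if t then a else b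
  let c : Bool → ℂ := fun t => if t then 3/5 else 4/5
  have e : ∀ U, mon4 a a a a i j i' j' (reflU a b hab * U) =
      ∑ p : Bool × Bool × Bool × Bool, (c p.1 * c p.2.1 * c p.2.2.1 * c p.2.2.2) *
        mon4 (f p.1) (f p.2.1) (f p.2.2.1) (f p.2.2.2) i j i' j' U := by
    intro U
    simp only [Fintype.sum_prod_type, Fintype.sum_bool]
    simp only [mon4, reflU_mul, map_add, map_mul, map_div₀, map_ofNat, f, c, if_true,
      Bool.false_eq_true, if_false]
    ring
  simp only [e] at h
  rw [integral_finsetSum _ fun p _ => (int_mon4 μ _ _ _ _ _ _ _ _).const_mul _] at h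
  simp only [integral_const_mul, ← mom4.eq_1] at h
  simp only [Fintype.sum_prod_type, Fintype.sum_bool] at h
  simp only [f, c, if_true, Bool.false_eq_true, if_false] at h
  have z := mom4_zero μ hμ i j i' j'
  have z1 := z a a b b (by simp [hab]) (by simp [hab])
  have z2 := z b b a a (by simp [hab.symm]) (by simp [hab.symm])
  have z3 := z a a a b (by simp [hab]) (by simp [hab])
  have z4 := z a a b a (by simp [hab]) (by simp [hab])
  have z5 := z a b a a (by simp [hab.symm]) (by simp [hab.symm])
  have z6 := z b a a a (by simp [hab.symm]) (by simp [hab.symm])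
  have z7 := z b b b a (by simp [hab.symm]) (by simp [hab.symm])
  have z8 := z b b a b (by simp [hab.symm]) (by simp [hab.symm])
  have z9 := z b a b b (by simp [hab]) (by simp [hab])
  have z10 := z a b b b (by simp [hab]) (by simp [hab])
  have s1 := mom4_perm μ hμ (Equiv.swap a b) i j i' j' b b b b
  have s2 := mom4_perm μ hμ (Equiv.swap a b) i j i' j' b a b a
  have s3 := mom4_perm μ hμ (Equiv.swap a b) i j i' j' b a a b
  simp only [Equiv.swap_apply_left, Equiv.swap_apply_right] at s1 s2 s3
  rw [z1, z2, z3, z4, z5, z6, z7, z8, z9, z10, s1, s2, s3] at h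
  linear_combination (625/288) * h

include hμ in
lemma mom4_form [Nontrivial ι] (i j i' j' : ι) : ∃ x y : ℂ, ∀ a b a' b',
    mom4 μ i j i' j' a b a' b' = (if a = a' ∧ b = b' then x else 0) +
      (if a = b' ∧ b = a' then y else 0) := by
  obtain ⟨a0, b0, h0⟩ := exists_pair_ne ι
  refine ⟨mom4 μ i j i' j' a0 b0 a0 b0, mom4 μ i j i' j' a0 b0 b0 a0, ?_⟩
  intro a b a' b'
  by_cases h1 : a = a' ∧ b = b'
  · obtain ⟨rfl, rfl⟩ := h1
    by_cases hab : a = b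
    · subst hab
      obtain ⟨c, hc⟩ := exists_ne a
      obtain ⟨σ, s1, s2⟩ := exists_perm a c a0 b0 hc.symm h0
      rw [mom4_perm μ hμ σ, s1, mom4_diag μ hμ _ _ _ _ a0 b0 h0]
      simp
    · obtain ⟨σ, s1, s2⟩ := exists_perm a b a0 b0 hab h0
      rw [mom4_perm μ hμ σ, s1, s2]
      simp [hab]
  · by_cases h2 : a = b' ∧ b = a'
    · obtain ⟨rfl, rfl⟩ := h2
      have hab : a ≠ b := by rintro rfl; simp at h1
      obtain ⟨σ, s1, s2⟩ := exists_perm a b a0 b0 hab h0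
      rw [mom4_perm μ hμ σ, s1, s2]
      simp [hab]
    · rw [mom4_zero μ hμ _ _ _ _ _ _ _ _ h1 h2]
      simp [h1, h2]

lemma unit_sum (U : Matrix.unitaryGroup ι ℂ) (i i' : ι) :
    ∑ a, (U : Matrix ι ι ℂ) a i * conj ((U : Matrix ι ι ℂ) a i') = if i = i' then 1 else 0 := by
  have h := congrFun (congrFun (Matrix.mem_unitaryGroup_iff'.1 U.2) i') i
  simp only [Matrix.mul_apply, Matrix.star_apply, Matrix.one_apply] at h
  rw [← Finset.sum_congr rfl fun a _ => mul_comm _ _] at h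
  simpa [eq_comm] using h

lemma mom4_sum1 (i j i' j' : ι) : ∑ a, ∑ b, mom4 μ i j i' j' a b a b =
    if i = i' ∧ j = j' then 1 else 0 := by
  simp only [mom4]
  rw [Finset.sum_congr rfl fun a _ => (integral_finsetSum _ fun b _ => int_mon4 μ _ _ _ _ _ _ _ _).symm,
    ← integral_finsetSum _ fun a _ => integrable_finsetSum _ fun b _ => int_mon4 μ _ _ _ _ _ _ _ _]
  have : ∀ U, ∑ a, ∑ b, mon4 a b a b i j i' j' U = if i = i' ∧ j = j' then 1 else 0 := by
    intro U
    have : (if i = i' ∧ j = j' then 1 else 0 : ℂ) =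
      (if i = i' then 1 else 0) * (if j = j' then 1 else 0) := by
        split_ifs <;> simp_all
    rw [this, ← unit_sum U i i', ← unit_sum U j j', Finset.sum_mul_sum]
    refine Finset.sum_congr rfl fun a _ => Finset.sum_congr rfl fun b _ => ?_
    simp only [mon4]; ring
  simp [this]

lemma mom4_sum2 (i j i' j' : ι) : ∑ a, ∑ b, mom4 μ i j i' j' a b b a =
    if i = j' ∧ j = i' then 1 else 0 := by
  rw [← mom4_sum1 μ i j j' i']
  refine Finset.sum_congr rfl fun a _ => Finset.sum_congr rfl fun b _ => ?_
  simp only [mom4, mon4]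
  congr 1; funext U; ring

/-- Weingarten coefficients -/
def wgx (q : ℂ) (P Q : Prop) [Decidable P] [Decidable Q] : ℂ :=
  (q * (if P then 1 else 0) - (if Q then 1 else 0)) / (q * (q^2-1))

include hμ in
lemma mom4_eq [Nontrivial ι] (i j i' j' a b a' b' : ι) :
    mom4 μ i j i' j' a b a' b' =
      (if a = a' ∧ b = b' then wgx (Fintype.card ι) (i = i' ∧ j = j') (i = j' ∧ j = i') else 0) +
      (if a = b' ∧ b = a' then wgx (Fintype.card ι) (i = j' ∧ j = i') (i = i' ∧ j = j') else 0) := by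
  obtain ⟨x, y, h⟩ := mom4_form μ hμ i j i' j'
  have h1 := mom4_sum1 μ i j i' j'
  have h2 := mom4_sum2 μ i j i' j'
  rw [Finset.sum_congr rfl fun a _ => Finset.sum_congr rfl fun b _ => h a b a b] at h1
  rw [Finset.sum_congr rfl fun a _ => Finset.sum_congr rfl fun b _ => h a b b a] at h2
  have e1 : ∑ a : ι, ∑ b : ι, ((if a = a ∧ b = b then x else 0) + (if a = b ∧ b = a then y else 0))
      = (Fintype.card ι : ℂ)^2 * x + (Fintype.card ι : ℂ) * y := by
    have : ∀ a b : ι, (a = b ∧ b = a) ↔ a = b := fun a b => ⟨fun h => h.1, fun h => ⟨h, h.symm⟩⟩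
    simp [this, Finset.sum_add_distrib]; ring
  have e2 : ∑ a : ι, ∑ b : ι, ((if a = b ∧ b = a then x else 0) + (if a = a ∧ b = b then y else 0))
      = (Fintype.card ι : ℂ) * x + (Fintype.card ι : ℂ)^2 * y := by
    have : ∀ a b : ι, (a = b ∧ b = a) ↔ a = b := fun a b => ⟨fun h => h.1, fun h => ⟨h, h.symm⟩⟩
    simp [this, Finset.sum_add_distrib]; ring
  rw [e1] at h1
  rw [e2] at h2
  have hq : 1 < Fintype.card ι := Fintype.one_lt_card
  have hq0 : (Fintype.card ι : ℂ) ≠ 0 := by exact_mod_cast (by omega : Fintype.card ι ≠ 0)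
  have hq1 : (Fintype.card ι : ℂ)^2 - 1 ≠ 0 := by
    rw [sub_ne_zero]
    exact_mod_cast (by nlinarith : Fintype.card ι ^ 2 ≠ 1)
  have hx : x = wgx (Fintype.card ι) (i = i' ∧ j = j') (i = j' ∧ j = i') := by
    rw [wgx, ← h1, ← h2, eq_div_iff (mul_ne_zero hq0 hq1)]; ring
  have hy : y = wgx (Fintype.card ι) (i = j' ∧ j = i') (i = i' ∧ j = j') := by
    rw [wgx, ← h1, ← h2, eq_div_iff (mul_ne_zero hq0 hq1)]; ring
  rw [h, ← hx, ← hy]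

end moments
section lists

lemma ofFn_prod_sum {R P : Type*} [Semiring R] [Fintype P] (n : ℕ) (M : Fin n → P → R) :
    ∑ p : Fin n → P, (List.ofFn fun k => M k (p k)).prod = (List.ofFn fun k => ∑ p, M k p).prod := by
  induction n with
  | zero => simp
  | succ n ih =>
    rw [← (Fin.consEquiv fun _ => P).sum_comp, Fintype.sum_prod_type]
    simp only [List.ofFn_succ, List.prod_cons, Fin.consEquiv_apply, Fin.cons_zero, Fin.cons_succ]
    rw [← ih, Finset.sum_mul_sum]

lemma ofFn_prod_kron {κ κ' : Type*} [Fintype κ] [Fintype κ'] [DecidableEq κ] [DecidableEq κ']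
    (n : ℕ) (f : Fin n → Matrix κ κ ℂ) (g : Fin n → Matrix κ' κ' ℂ) :
    kroneckerMap (· * ·) (List.ofFn f).prod (List.ofFn g).prod =
      (List.ofFn fun k => kroneckerMap (· * ·) (f k) (g k)).prod := by
  induction n with
  | zero => simp
  | succ n ih =>
    simp only [List.ofFn_succ, List.prod_cons]
    rw [← ih]
    exact Matrix.mul_kronecker_mul _ _ _ _

lemma conj_trace_ofFn {κ : Type*} [Fintype κ] [DecidableEq κ]
    (n : ℕ) (f : Fin n → Matrix κ κ ℂ) :
    conj (Matrix.trace (List.ofFn f).prod) =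
      Matrix.trace (List.ofFn fun k => (f k).map conj).prod := by
  have h : ((List.ofFn f).prod).map (conj : ℂ →+* ℂ) = (List.ofFn fun k => (f k).map conj).prod := by
    have := map_list_prod (RingHom.mapMatrix (m := κ) (conj : ℂ →+* ℂ)) (List.ofFn f)
    rw [List.map_ofFn] at this
    exact this
  rw [← h]
  simp [Matrix.trace]

lemma integral_ofFn {Ω κ : Type*} [MeasurableSpace Ω] [Fintype κ] [DecidableEq κ]
    (μ : Measure Ω) [IsProbabilityMeasure μ] (n : ℕ) (g : Fin n → Ω → Matrix κ κ ℂ)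
    (hg : ∀ k a b, Integrable (fun ω => g k ω a b) μ) (a b : κ) :
    Integrable (fun U : Fin n → Ω => (List.ofFn fun k => g k (U k)).prod a b)
      (Measure.pi fun _ => μ) ∧
    ∫ U : Fin n → Ω, (List.ofFn fun k => g k (U k)).prod a b ∂(Measure.pi fun _ => μ) =
      (List.ofFn fun k => Matrix.of fun a b => ∫ ω, g k ω a b ∂μ).prod a b := by
  induction n generalizing a b with
  | zero => simp
  | succ n ih =>
    have e := measurePreserving_piFinSuccAbove (fun _ : Fin (n+1) => μ) 0
    let H : Ω × (Fin n → Ω) → ℂ := fun p =>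
      ∑ c, g 0 p.1 a c * (List.ofFn fun k => g k.succ (p.2 k)).prod c b
    have hU : (fun U : Fin (n+1) → Ω => (List.ofFn fun k => g k (U k)).prod a b) =
        H ∘ (MeasurableEquiv.piFinSuccAbove (fun _ => Ω) 0) := by
      funext U
      simp only [List.ofFn_succ, List.prod_cons, Matrix.mul_apply, H, Function.comp]
      rfl
    have hI : ∀ c, Integrable (fun p : Ω × (Fin n → Ω) =>
        g 0 p.1 a c * (List.ofFn fun k => g k.succ (p.2 k)).prod c b)
        (μ.prod (Measure.pi fun _ => μ)) := fun c =>
      (hg 0 a c).mul_prod (ih (fun k => g k.succ) (fun k => hg k.succ) c b).1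
    have hH : Integrable H (μ.prod (Measure.pi fun _ => μ)) :=
      integrable_finsetSum _ fun c _ => hI c
    rw [hU]
    refine ⟨(e.integrable_comp_emb (MeasurableEquiv.measurableEmbedding _)).2 hH, ?_⟩
    have := e.integral_comp (MeasurableEquiv.measurableEmbedding _) H
    refine this.trans ?_
    simp only [H]
    rw [integral_finsetSum _ fun c _ => hI c]
    simp only [List.ofFn_succ, List.prod_cons, Matrix.mul_apply]
    refine Finset.sum_congr rfl fun c _ => ?_
    have h2 := integral_prod_mul (μ := μ) (ν := Measure.pi fun _ : Fin n => μ)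
      (fun x => g 0 x a c) (fun y => (List.ofFn fun k => g k.succ (y k)).prod c b)
    refine h2.trans ?_
    rw [(ih (fun k => g k.succ) (fun k => hg k.succ) c b).2]
    rfl

lemma integral_trace_ofFn {Ω κ : Type*} [MeasurableSpace Ω] [Fintype κ] [DecidableEq κ]
    (μ : Measure Ω) [IsProbabilityMeasure μ] (n : ℕ) (g : Fin n → Ω → Matrix κ κ ℂ)
    (hg : ∀ k a b, Integrable (fun ω => g k ω a b) μ) :
    Integrable (fun U : Fin n → Ω => Matrix.trace (List.ofFn fun k => g k (U k)).prod)
      (Measure.pi fun _ => μ) ∧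
    ∫ U : Fin n → Ω, Matrix.trace (List.ofFn fun k => g k (U k)).prod ∂(Measure.pi fun _ => μ) =
      Matrix.trace (List.ofFn fun k => Matrix.of fun a b => ∫ ω, g k ω a b ∂μ).prod := by
  have h := integral_ofFn μ n g hg
  simp only [Matrix.trace, Matrix.diag]
  refine ⟨integrable_finsetSum _ fun c _ => (h c c).1, ?_⟩
  rw [integral_finsetSum _ fun c _ => (h c c).1]
  exact Finset.sum_congr rfl fun c _ => (h c c).2

end lists

section model
variable (d D : ℕ) [NeZero d]

/-- four-fold site tensor -/
def site4 (U : Matrix.unitaryGroup (Fin d × Fin D) ℂ) (i j i' j' : Fin d) :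
    Matrix ((Fin D × Fin D) × (Fin D × Fin D)) ((Fin D × Fin D) × (Fin D × Fin D)) ℂ :=
  kroneckerMap (· * ·) (kroneckerMap (· * ·) (siteMat d D U i) (siteMat d D U j))
    (kroneckerMap (· * ·) ((siteMat d D U i').map conj) ((siteMat d D U j').map conj))

/-- summed site tensor -/
def siteE (s : Bool) (U : Matrix.unitaryGroup (Fin d × Fin D) ℂ) :
    Matrix ((Fin D × Fin D) × (Fin D × Fin D)) ((Fin D × Fin D) × (Fin D × Fin D)) ℂ :=
  ∑ p : Fin d × Fin d, site4 d D U p.1 p.2 (if s then p.2 else p.1) (if s then p.1 else p.2)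

/-- replica functional -/
def repF {n : ℕ} (s : Fin n → Bool) (ψ : (Fin n → Fin d) → ℂ) : ℂ :=
  ∑ i : Fin n → Fin d, ∑ j : Fin n → Fin d, ψ i * ψ j *
    (conj (ψ fun k => if s k then j k else i k) * conj (ψ fun k => if s k then i k else j k))

lemma mps_eq (n : ℕ) (U : Fin n → Matrix.unitaryGroup (Fin d × Fin D) ℂ) (i : Fin n → Fin d) :
    mps d D n U i = Matrix.trace (List.ofFn fun k => siteMat d D (U k) (i k)).prod := by
  rw [mps, List.ofFn_eq_map]

lemma trace_kron' {κ κ' : Type*} [Fintype κ] [Fintype κ'] (A : Matrix κ κ ℂ) (B : Matrix κ' κ' ℂ) :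
    Matrix.trace (kroneckerMap (· * ·) A B) = Matrix.trace A * Matrix.trace B :=
  Matrix.trace_kronecker A B

lemma repF_mps (n : ℕ) (s : Fin n → Bool) (U : Fin n → Matrix.unitaryGroup (Fin d × Fin D) ℂ) :
    repF d s (mps d D n U) = Matrix.trace (List.ofFn fun k => siteE d D (s k) (U k)).prod := by
  unfold siteE
  rw [← ofFn_prod_sum n fun k (p : Fin d × Fin d) => site4 d D (U k) p.1 p.2
    (if s k then p.2 else p.1) (if s k then p.1 else p.2)]
  rw [← (Equiv.arrowProdEquivProdArrow (Fin n) (fun _ => Fin d) (fun _ => Fin d)).symm.sum_comp,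
    Fintype.sum_prod_type, Matrix.trace_sum, repF]
  refine Finset.sum_congr rfl fun i _ => ?_
  rw [Matrix.trace_sum]
  refine Finset.sum_congr rfl fun j _ => ?_
  simp only [Equiv.arrowProdEquivProdArrow_symm_apply, site4]
  rw [← ofFn_prod_kron, ← ofFn_prod_kron, ← ofFn_prod_kron, trace_kron', trace_kron', trace_kron',
    ← conj_trace_ofFn, ← conj_trace_ofFn]
  simp only [mps_eq]

lemma norm_mps (n : ℕ) (U : Fin n → Matrix.unitaryGroup (Fin d × Fin D) ℂ) :
    ∑ i, mps d D n U i * conj (mps d D n U i) = Matrix.trace (List.ofFn fun k =>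
      ∑ p : Fin d, kroneckerMap (· * ·) (siteMat d D (U k) p) ((siteMat d D (U k) p).map conj)).prod := by
  rw [← ofFn_prod_sum n fun k (p : Fin d) => kroneckerMap (· * ·) (siteMat d D (U k) p)
    ((siteMat d D (U k) p).map conj), Matrix.trace_sum]
  refine Finset.sum_congr rfl fun i _ => ?_
  rw [← ofFn_prod_kron, trace_kron', ← conj_trace_ofFn, mps_eq]

variable (μ : Measure (Matrix.unitaryGroup (Fin d × Fin D) ℂ)) [IsProbabilityMeasure μ]

lemma siteE_apply (s : Bool) (U : Matrix.unitaryGroup (Fin d × Fin D) ℂ)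
    (x y : (Fin D × Fin D) × (Fin D × Fin D)) :
    siteE d D s U x y = ∑ p : Fin d × Fin d, mon4 (p.1, x.1.1) (p.2, x.1.2)
      (if s then p.2 else p.1, x.2.1) (if s then p.1 else p.2, x.2.2)
      (0, y.1.1) (0, y.1.2) (0, y.2.1) (0, y.2.2) U := by
  simp only [siteE, Matrix.sum_apply]
  rfl

lemma int_siteE (s : Bool) (x y : (Fin D × Fin D) × (Fin D × Fin D)) :
    Integrable (fun U => siteE d D s U x y) μ := by
  simp only [siteE_apply]
  exact integrable_finsetSum _ fun p _ => int_mon4 μ _ _ _ _ _ _ _ _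

/-- permutation vectors -/
def matR : Matrix ((Fin D × Fin D) × (Fin D × Fin D)) Bool ℂ :=
  Matrix.of fun x σ => if σ then (if x.1.1 = x.2.2 ∧ x.1.2 = x.2.1 then 1 else 0)
    else (if x.1.1 = x.2.1 ∧ x.1.2 = x.2.2 then 1 else 0)

/-- dual vectors -/
def matW : Matrix Bool ((Fin D × Fin D) × (Fin D × Fin D)) ℂ :=
  Matrix.of fun σ x => if σ
    then wgx (d * D) (x.1.1 = x.2.2 ∧ x.1.2 = x.2.1) (x.1.1 = x.2.1 ∧ x.1.2 = x.2.2)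
    else wgx (d * D) (x.1.1 = x.2.1 ∧ x.1.2 = x.2.2) (x.1.1 = x.2.2 ∧ x.1.2 = x.2.1)

/-- physical weights -/
def matDl (s : Bool) : Matrix Bool Bool ℂ :=
  Matrix.diagonal fun σ => if σ = s then (d:ℂ)^2 else d

variable (hμ : ∀ V : Matrix.unitaryGroup (Fin d × Fin D) ℂ, μ.map (fun U => V * U) = μ)

include hμ in
lemma integral_siteE (hd : 2 ≤ d) (hD : 2 ≤ D) (s : Bool) :
    (Matrix.of fun x y => ∫ U, siteE d D s U x y ∂μ) = matR D * (matDl d s * matW d D) := by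
  haveI : Nontrivial (Fin d) := Fin.nontrivial_iff_two_le.2 hd
  haveI : Nontrivial (Fin D) := Fin.nontrivial_iff_two_le.2 hD
  ext x y
  rw [Matrix.of_apply]
  simp only [siteE_apply]
  rw [integral_finsetSum _ fun p _ => int_mon4 μ _ _ _ _ _ _ _ _]
  simp only [← mom4.eq_1, mom4_eq μ hμ, Matrix.mul_apply, Fintype.sum_bool, Fintype.card_prod,
    Fintype.card_fin, Nat.cast_mul, Prod.mk.injEq, true_and]
  obtain ⟨⟨a, c⟩, ⟨a', c'⟩⟩ := x
  obtain ⟨⟨b, e⟩, ⟨b', e'⟩⟩ := y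
  simp only [matR, matDl, matW, Matrix.of_apply, Matrix.diagonal_apply, if_true,
    Bool.false_eq_true, if_false]
  have h1 : ∀ x y : Fin d, (x = y ∧ y = x) ↔ x = y := fun a b => ⟨fun h => h.1, fun h => ⟨h, h.symm⟩⟩
  generalize hX : wgx (d * D : ℂ) (b = b' ∧ e = e') (b = e' ∧ e = b') = X
  generalize hY : wgx (d * D : ℂ) (b = e' ∧ e = b') (b = b' ∧ e = e') = Y
  rw [Fintype.sum_prod_type]
  by_cases hP : a = a' ∧ c = c' <;> by_cases hQ : a = c' ∧ c = a' <;> cases s <;>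
    simp [and_and_and_comm, hP, hQ, h1, Finset.sum_add_distrib] <;>
    first
    | ring1
    | (by_cases h5 : a' = c'
       · simp [h5]; try ring1
       · have h6 : ¬ c' = a' := fun h => h5 h.symm
         simp [h5, h6]; try ring1)

end model
section first
variable {ι : Type*} [Fintype ι] [DecidableEq ι] [Nontrivial ι]

lemma int_mon2 (μ : Measure (Matrix.unitaryGroup ι ℂ)) [IsProbabilityMeasure μ] (i i' a a' : ι) :
    Integrable (fun U : Matrix.unitaryGroup ι ℂ =>
      (U : Matrix ι ι ℂ) a i * conj ((U : Matrix ι ι ℂ) a' i')) μ := by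
  refine Integrable.of_bound ((meas_entry _ _).mul
    (Complex.continuous_conj.measurable.comp (meas_entry _ _))).aestronglyMeasurable 1
    (Filter.Eventually.of_forall fun U => ?_)
  simp only [norm_mul, RCLike.norm_conj]
  exact mul_le_one₀ (norm_entry _ _ _) (norm_nonneg _) (norm_entry _ _ _)

lemma mom2_eq (μ : Measure (Matrix.unitaryGroup ι ℂ)) [IsProbabilityMeasure μ]
    (hμ : ∀ V : Matrix.unitaryGroup ι ℂ, μ.map (fun U => V * U) = μ) (i i' a a' : ι) :
    ∫ U : Matrix.unitaryGroup ι ℂ, (U : Matrix ι ι ℂ) a i * conj ((U : Matrix ι ι ℂ) a' i') ∂μ =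
      if a = a' ∧ i = i' then 1 / (Fintype.card ι : ℂ) else 0 := by
  have h : ∀ U : Matrix.unitaryGroup ι ℂ, (U : Matrix ι ι ℂ) a i * conj ((U : Matrix ι ι ℂ) a' i') =
      ∑ b, mon4 a b a' b i i i' i U := by
    intro U
    have := unit_sum U i i
    simp only [if_true] at this
    rw [← mul_one (_ * _), ← this, Finset.mul_sum]
    refine Finset.sum_congr rfl fun b _ => ?_
    simp only [mon4]; ring
  simp only [h]
  rw [integral_finsetSum _ fun b _ => int_mon4 μ _ _ _ _ _ _ _ _]
  simp only [← mom4.eq_1, mom4_eq μ hμ]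
  have hq : 1 < Fintype.card ι := Fintype.one_lt_card
  have hq0 : (Fintype.card ι : ℂ) ≠ 0 := by exact_mod_cast (by omega : Fintype.card ι ≠ 0)
  have hq1 : (Fintype.card ι : ℂ)^2 - 1 ≠ 0 := by
    rw [sub_ne_zero]
    exact_mod_cast (by nlinarith : Fintype.card ι ^ 2 ≠ 1)
  by_cases ha : a = a'
  · subst ha
    have e : ∀ b : ι, (a = b ∧ b = a) ↔ a = b := fun b => ⟨fun h => h.1, fun h => ⟨h, h.symm⟩⟩
    simp only [and_self, if_true, true_and, e, Finset.sum_add_distrib, Finset.sum_ite_eq,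
      Finset.mem_univ, Finset.sum_const, Finset.card_univ, nsmul_eq_mul]
    by_cases hi : i = i'
    · subst hi
      simp [wgx]; field_simp; ring
    · simp [wgx, hi]
  · have e : ∀ b : ι, ¬ (a = b ∧ b = a') := fun b h => ha (h.1.trans h.2)
    simp [ha, e]

end first

section model2
variable (d D : ℕ) [NeZero d]

lemma siteN_int (μ : Measure (Matrix.unitaryGroup (Fin d × Fin D) ℂ)) [IsProbabilityMeasure μ]
    (hd : 2 ≤ d) (hD : 2 ≤ D) (x y : Fin D × Fin D) :
    Integrable (fun U => (∑ p : Fin d, kroneckerMap (· * ·) (siteMat d D U p)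
      ((siteMat d D U p).map conj)) x y) μ := by
  haveI : Nontrivial (Fin d) := Fin.nontrivial_iff_two_le.2 hd
  haveI : Nontrivial (Fin D) := Fin.nontrivial_iff_two_le.2 hD
  simp only [Matrix.sum_apply]
  exact integrable_finsetSum _ fun p _ => int_mon2 μ (0, y.1) (0, y.2) (p, x.1) (p, x.2)

lemma siteN_integral (μ : Measure (Matrix.unitaryGroup (Fin d × Fin D) ℂ)) [IsProbabilityMeasure μ]
    (hμ : ∀ V : Matrix.unitaryGroup (Fin d × Fin D) ℂ, μ.map (fun U => V * U) = μ)
    (hd : 2 ≤ d) (hD : 2 ≤ D) :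
    (Matrix.of fun x y => ∫ U, (∑ p : Fin d, kroneckerMap (· * ·) (siteMat d D U p)
      ((siteMat d D U p).map conj)) x y ∂μ) =
    Matrix.vecMulVec (fun x : Fin D × Fin D => if x.1 = x.2 then (1:ℂ) else 0)
      (fun x : Fin D × Fin D => if x.1 = x.2 then 1/(D:ℂ) else 0) := by
  haveI : Nontrivial (Fin d) := Fin.nontrivial_iff_two_le.2 hd
  haveI : Nontrivial (Fin D) := Fin.nontrivial_iff_two_le.2 hD
  ext x y
  simp only [Matrix.of_apply, Matrix.sum_apply]
  have h := integral_finsetSum (μ := μ) (Finset.univ : Finset (Fin d))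
    fun p _ => int_mon2 μ ((0 : Fin d), y.1) (0, y.2) (p, x.1) (p, x.2)
  refine h.trans ?_
  simp only [mom2_eq μ hμ]
  have hd0 : (d : ℂ) ≠ 0 := by exact_mod_cast (by omega : d ≠ 0)
  have hD0 : (D : ℂ) ≠ 0 := by exact_mod_cast (by omega : D ≠ 0)
  simp only [Prod.mk.injEq, true_and, Matrix.vecMulVec_apply, Finset.sum_const, Finset.card_univ,
    Fintype.card_prod, Fintype.card_fin, nsmul_eq_mul]
  by_cases h1 : x.1 = x.2 <;> by_cases h2 : y.1 = y.2 <;> simp [h1, h2]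
  field_simp

lemma integral_norm (μ : Measure (Matrix.unitaryGroup (Fin d × Fin D) ℂ)) [IsProbabilityMeasure μ]
    (hμ : ∀ V : Matrix.unitaryGroup (Fin d × Fin D) ℂ, μ.map (fun U => V * U) = μ)
    (hd : 2 ≤ d) (hD : 2 ≤ D) (n : ℕ) (hn : n ≠ 0) :
    Integrable (fun U => ∑ i, mps d D n U i * conj (mps d D n U i)) (Measure.pi fun _ => μ) ∧
    ∫ U, ∑ i, mps d D n U i * conj (mps d D n U i) ∂(Measure.pi fun _ : Fin n => μ) = 1 := by
  simp only [norm_mps]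
  have h := integral_trace_ofFn μ n (fun _ U => ∑ p : Fin d, kroneckerMap (· * ·) (siteMat d D U p)
      ((siteMat d D U p).map conj)) fun _ => siteN_int d D μ hd hD
  refine ⟨h.1, ?_⟩
  rw [h.2, siteN_integral d D μ hμ hd hD, List.ofFn_const, List.prod_replicate]
  have hD0 : (D : ℂ) ≠ 0 := by exact_mod_cast (by omega : D ≠ 0)
  have h1 : (fun x : Fin D × Fin D => if x.1 = x.2 then 1/(D:ℂ) else 0) ⬝ᵥ
      (fun x : Fin D × Fin D => if x.1 = x.2 then (1:ℂ) else 0) = 1 := by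
    simp [dotProduct, Fintype.sum_prod_type, hD0]
  have h2 : IsIdempotentElem (Matrix.vecMulVec
      (fun x : Fin D × Fin D => if x.1 = x.2 then (1:ℂ) else 0)
      (fun x : Fin D × Fin D => if x.1 = x.2 then 1/(D:ℂ) else 0)) := by
    rw [IsIdempotentElem, Matrix.vecMulVec_mul_vecMulVec, h1, one_smul]
  rw [h2.pow_eq hn, Matrix.trace_vecMulVec, dotProduct_comm, h1]

/-- column vectors of the rank one projections -/
def vecv (s σ : Bool) : ℂ := if σ = s then (d * D : ℂ) else 1

/-- row vectors of the rank one projections -/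
def vecw (s σ : Bool) : ℂ := (if σ = s then (D : ℂ) else 1) / (d * D ^ 2 + 1)

/-- eta -/
def etaC : ℂ := (d * D ^ 2 - d) / (d ^ 2 * D ^ 2 - 1)

lemma den_ne (hd : 2 ≤ d) (hD : 2 ≤ D) : (d * D ^ 2 + 1 : ℂ) ≠ 0 ∧ (d ^ 2 * D ^ 2 - 1 : ℂ) ≠ 0 := by
  constructor
  · exact_mod_cast (by positivity : d * D ^ 2 + 1 ≠ 0)
  · rw [sub_ne_zero]
    have : 1 < d ^ 2 * D ^ 2 := by
      have : 1 < d * D := by nlinarith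
      nlinarith
    exact_mod_cast this.ne'

lemma matW_mul_matR (σ τ : Bool) : (matW d D * matR D) σ τ =
    if σ = τ then (d * D * D ^ 2 - D : ℂ) / (d * D * ((d*D)^2-1))
      else (d * D * D - D ^ 2 : ℂ) / (d * D * ((d*D)^2-1)) := by
  have h1 : ∑ x : (Fin D × Fin D) × (Fin D × Fin D),
      (if x.1.1 = x.2.1 ∧ x.1.2 = x.2.2 then (1:ℂ) else 0) = D ^ 2 := by
    simp [Fintype.sum_prod_type, ite_and]; ring
  have h2 : ∑ x : (Fin D × Fin D) × (Fin D × Fin D),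
      (if x.1.1 = x.2.2 ∧ x.1.2 = x.2.1 then (1:ℂ) else 0) = D ^ 2 := by
    simp [Fintype.sum_prod_type, ite_and]; ring
  have h3 : ∑ x : (Fin D × Fin D) × (Fin D × Fin D),
      (if x.1.1 = x.2.1 ∧ x.1.2 = x.2.2 then (1:ℂ) else 0) *
      (if x.1.1 = x.2.2 ∧ x.1.2 = x.2.1 then (1:ℂ) else 0) = D := by
    simp [Fintype.sum_prod_type, ite_and]
  have h3' : ∑ x : (Fin D × Fin D) × (Fin D × Fin D),
      (if x.1.1 = x.2.2 ∧ x.1.2 = x.2.1 then (1:ℂ) else 0) *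
      (if x.1.1 = x.2.1 ∧ x.1.2 = x.2.2 then (1:ℂ) else 0) = D := by
    rw [← h3]
    exact Finset.sum_congr rfl fun x _ => mul_comm _ _
  have hs : ∀ (P : Prop) [Decidable P], (if P then (1:ℂ) else 0) * (if P then (1:ℂ) else 0) =
      if P then (1:ℂ) else 0 := by intro P _; split_ifs <;> simp
  simp only [Matrix.mul_apply, matW, matR, Matrix.of_apply, wgx]
  cases σ <;> cases τ <;> simp only [if_true, Bool.false_eq_true, if_false, Bool.true_eq_false]
  all_goals
    simp only [div_mul_eq_mul_div, ← Finset.sum_div, sub_mul, mul_assoc, hs, Finset.sum_sub_distrib,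
      ← Finset.mul_sum, h1, h2, h3, h3']

lemma matT_eq (hd : 2 ≤ d) (hD : 2 ≤ D) (s : Bool) : matDl d s * matW d D * matR D =
    Matrix.vecMulVec (vecv d D s) (vecw d D s) +
      etaC d D • (1 - Matrix.vecMulVec (vecv d D s) (vecw d D s)) := by
  have hd0 : (d : ℂ) ≠ 0 := by exact_mod_cast (by omega : d ≠ 0)
  have hD0 : (D : ℂ) ≠ 0 := by exact_mod_cast (by omega : D ≠ 0)
  obtain ⟨e1, e2⟩ := den_ne d D hd hD
  have e3 : ((d * D : ℂ)^2 - 1) ≠ 0 := by rwa [mul_pow]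
  ext σ τ
  rw [Matrix.mul_assoc, matDl, Matrix.diagonal_mul, matW_mul_matR]
  simp only [Matrix.add_apply, Matrix.smul_apply, Matrix.sub_apply, Matrix.one_apply,
    Matrix.vecMulVec_apply, vecv, vecw, etaC, smul_eq_mul]
  cases s <;> cases σ <;> cases τ <;>
    simp only [if_true, Bool.false_eq_true, if_false, Bool.true_eq_false] <;> field_simp <;> ring

end model2
section fin
variable (d D : ℕ) [NeZero d]

lemma pow_idem {κ : Type*} [Fintype κ] [DecidableEq κ] (P : Matrix κ κ ℂ) (hP : P * P = P) (e : ℂ)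
    (k : ℕ) : (P + e • (1 - P)) ^ k = P + e ^ k • (1 - P) := by
  induction k with
  | zero => simp
  | succ k ih =>
    rw [pow_succ, ih]
    simp only [add_mul, mul_add, smul_mul_assoc, mul_smul_comm, mul_sub, sub_mul, mul_one, one_mul,
      hP, sub_self, smul_zero, sub_zero, add_zero, zero_add, smul_smul, pow_succ]
    module

/-- real eta -/
def etaR : ℝ := (d * D ^ 2 - d) / (d ^ 2 * D ^ 2 - 1)

/-- overlap -/
def ovl : ℝ := ((d + 1) * D / (d * D ^ 2 + 1)) ^ 2

/-- expected replica functional -/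
def expF (l m : ℕ) : ℝ := etaR d D ^ l + etaR d D ^ m +
  (1 - etaR d D ^ l) * (1 - etaR d D ^ m) * ovl d D

lemma vecw_dot (hd : 2 ≤ d) (hD : 2 ≤ D) (s t : Bool) : vecw d D s ⬝ᵥ vecv d D t =
    if s = t then 1 else ((d:ℂ) + 1) * D / (d * D ^ 2 + 1) := by
  obtain ⟨e1, e2⟩ := den_ne d D hd hD
  cases s <;> cases t <;>
    simp only [dotProduct, vecw, vecv, Fintype.sum_bool, if_true, Bool.false_eq_true, if_false,
      Bool.true_eq_false, div_mul_eq_mul_div, ← add_div] <;>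
    first
    | (rw [div_eq_one_iff_eq e1]; ring1)
    | (congr 1; ring1)

lemma trace_T (hd : 2 ≤ d) (hD : 2 ≤ D) (l m : ℕ) :
    Matrix.trace ((matDl d true * matW d D * matR D) ^ l * (matDl d false * matW d D * matR D) ^ m) =
      (expF d D l m : ℂ) := by
  have hP : ∀ s, Matrix.vecMulVec (vecv d D s) (vecw d D s) * Matrix.vecMulVec (vecv d D s) (vecw d D s)
      = Matrix.vecMulVec (vecv d D s) (vecw d D s) := by
    intro s
    rw [Matrix.vecMulVec_mul_vecMulVec, vecw_dot d D hd hD]; simp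
  have ht : ∀ s, Matrix.trace (Matrix.vecMulVec (vecv d D s) (vecw d D s)) = 1 := by
    intro s
    rw [Matrix.trace_vecMulVec, dotProduct_comm, vecw_dot d D hd hD]; simp
  have ho : Matrix.trace (Matrix.vecMulVec (vecv d D true) (vecw d D true) *
      Matrix.vecMulVec (vecv d D false) (vecw d D false)) = ovl d D := by
    rw [Matrix.vecMulVec_mul_vecMulVec, vecw_dot d D hd hD, Matrix.trace_vecMulVec,
      dotProduct_smul, dotProduct_comm, vecw_dot d D hd hD]
    simp [ovl, sq]
  have he : etaC d D = etaR d D := by simp [etaC, etaR]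
  rw [matT_eq d D hd hD, matT_eq d D hd hD, pow_idem _ (hP _), pow_idem _ (hP _)]
  simp only [add_mul, mul_add, smul_mul_assoc, mul_smul_comm, mul_sub, sub_mul, mul_one, one_mul,
    Matrix.trace_add, Matrix.trace_sub, Matrix.trace_smul, ht, ho, smul_eq_mul, he, expF,
    Matrix.trace_one, Fintype.card_bool]
  push_cast
  ring

lemma pow_mul_shift {κ : Type*} [Fintype κ] [DecidableEq κ] (R : Matrix κ Bool ℂ)
    (Y : Matrix Bool κ ℂ) (k : ℕ) : (R * Y) ^ k * R = R * (Y * R) ^ k := by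
  induction k with
  | zero => simp
  | succ k ih =>
    rw [pow_succ', Matrix.mul_assoc, ih, pow_succ', Matrix.mul_assoc, Matrix.mul_assoc]

lemma trace_K {κ : Type*} [Fintype κ] [DecidableEq κ] (R : Matrix κ Bool ℂ)
    (Y Y' : Matrix Bool κ ℂ) (l m : ℕ) :
    Matrix.trace ((R * Y) ^ l * (R * Y') ^ (m+1)) = Matrix.trace ((Y * R) ^ l * (Y' * R) ^ (m+1)) := by
  have : (R * Y) ^ l * (R * Y') ^ (m+1) = R * ((Y * R) ^ l * (Y' * R) ^ m * Y') := by
    rw [pow_succ, ← Matrix.mul_assoc (((R * Y') ^ m)), pow_mul_shift, ← Matrix.mul_assoc,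
      ← Matrix.mul_assoc, pow_mul_shift]
    simp only [Matrix.mul_assoc]
  rw [this, Matrix.trace_mul_comm, Matrix.mul_assoc, Matrix.mul_assoc, ← pow_succ]

lemma integral_repF (μ : Measure (Matrix.unitaryGroup (Fin d × Fin D) ℂ)) [IsProbabilityMeasure μ]
    (hμ : ∀ V : Matrix.unitaryGroup (Fin d × Fin D) ℂ, μ.map (fun U => V * U) = μ)
    (hd : 2 ≤ d) (hD : 2 ≤ D) (n l m : ℕ) (hn : n = l + (m + 1)) :
    Integrable (fun U => repF d (fun k : Fin n => decide ((k:ℕ) < l)) (mps d D n U))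
      (Measure.pi fun _ => μ) ∧
    ∫ U, repF d (fun k : Fin n => decide ((k:ℕ) < l)) (mps d D n U) ∂(Measure.pi fun _ : Fin n => μ) =
      (expF d D l (m+1) : ℂ) := by
  subst hn
  simp only [repF_mps]
  have h := integral_trace_ofFn μ (l + (m+1)) (fun k U => siteE d D (decide ((k:ℕ) < l)) U)
    fun k => int_siteE d D μ _
  refine ⟨h.1, ?_⟩
  rw [h.2]
  simp only [integral_siteE d D μ hμ hd hD]
  rw [List.ofFn_add]
  simp only [Fin.val_castLE, Fin.val_natAdd, Fin.is_lt, decide_true, Nat.not_lt.2 (Nat.le_add_right l _),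
    decide_false]
  rw [List.ofFn_const, List.ofFn_const, List.prod_append, List.prod_replicate, List.prod_replicate,
    trace_K, trace_T d D hd hD]

end fin

section dens
variable {n d : ℕ} (A : Finset (Fin n)) (ψ : (Fin n → Fin d) → ℂ)

/-- splitting configurations -/
def cfgEquiv : (((i : A) → Fin d) × ((i : (Aᶜ : Finset (Fin n))) → Fin d)) ≃ (Fin n → Fin d) where
  toFun p := mergeCfg A p.1 p.2
  invFun f := (fun i => f i, fun i => f i)
  left_inv p := by
    obtain ⟨x, z⟩ := p
    ext i
    · simp [mergeCfg, i.2]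
    · have := Finset.mem_compl.1 i.2
      simp [mergeCfg, this]
  right_inv f := by
    funext i
    simp [mergeCfg]

lemma sum_cfg {M : Type*} [AddCommMonoid M] (f : (Fin n → Fin d) → M) :
    ∑ i, f i = ∑ x, ∑ z, f (mergeCfg A x z) := by
  rw [← (cfgEquiv A).sum_comp, Fintype.sum_prod_type]
  rfl

lemma merge_mix (x y : (i : A) → Fin d) (z w : (i : (Aᶜ : Finset (Fin n))) → Fin d) :
    (fun k => if decide (k ∈ A) = true then mergeCfg A y w k else mergeCfg A x z k) =
      mergeCfg A y z := by
  funext k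
  by_cases h : k ∈ A <;> simp [mergeCfg, h]

lemma trace_rho_sq : Matrix.trace (rhoA A ψ * rhoA A ψ) = repF d (fun k => decide (k ∈ A)) ψ := by
  rw [repF, sum_cfg A]
  simp only [Matrix.trace, Matrix.diag, Matrix.mul_apply]
  refine Finset.sum_congr rfl fun x _ => ?_
  simp only [sum_cfg A (fun j : Fin n → Fin d => ψ _ * ψ j * _), merge_mix]
  rw [Finset.sum_comm]
  refine Finset.sum_congr rfl fun y _ => ?_
  simp only [rhoA, Matrix.of_apply]
  rw [Finset.sum_mul_sum]
  refine Finset.sum_congr rfl fun z _ => Finset.sum_congr rfl fun w _ => ?_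
  ring

lemma norm_eq : ∑ i, ψ i * conj (ψ i) = ((∑ i, ‖ψ i‖ ^ 2 : ℝ) : ℂ) := by
  push_cast
  exact Finset.sum_congr rfl fun i _ => by rw [Complex.mul_conj, Complex.normSq_eq_norm_sq]; push_cast; rfl

lemma repF_zero : repF d (fun k : Fin n => decide ((k:ℕ) < 0)) ψ = (((∑ i, ‖ψ i‖ ^ 2) ^ 2 : ℝ) : ℂ) := by
  rw [Complex.ofReal_pow, ← norm_eq, sq, Finset.sum_mul_sum, repF]
  refine Finset.sum_congr rfl fun z _ => Finset.sum_congr rfl fun w _ => ?_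
  simp
  ring

lemma purity_ge : (∑ i, ‖ψ i‖ ^ 2) ^ 2 ≤ (d:ℝ) ^ A.card * (Matrix.trace (rhoA A ψ * rhoA A ψ)).re := by
  have h1 : (Matrix.trace (rhoA A ψ * rhoA A ψ)).re = ∑ x, ∑ y, ‖rhoA A ψ x y‖ ^ 2 := by
    simp only [Matrix.trace, Matrix.diag, Matrix.mul_apply, Complex.re_sum]
    refine Finset.sum_congr rfl fun x _ => Finset.sum_congr rfl fun y _ => ?_
    have : rhoA A ψ y x = conj (rhoA A ψ x y) := by
      simp only [rhoA, Matrix.of_apply, map_sum, map_mul, Complex.conj_conj]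
      exact Finset.sum_congr rfl fun z _ => mul_comm _ _
    rw [this, Complex.mul_conj, Complex.normSq_eq_norm_sq, Complex.ofReal_re]
  have h2 : ∑ i, ‖ψ i‖ ^ 2 ≤ ∑ x, ‖rhoA A ψ x x‖ := by
    have : ∑ x, rhoA A ψ x x = ((∑ i, ‖ψ i‖ ^ 2 : ℝ) : ℂ) := by
      rw [← norm_eq, sum_cfg A]
      rfl
    calc ∑ i, ‖ψ i‖ ^ 2 ≤ ‖((∑ i, ‖ψ i‖ ^ 2 : ℝ) : ℂ)‖ := by
          rw [Complex.norm_real]; exact le_abs_self _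
      _ ≤ _ := by rw [← this]; exact norm_sum_le _ _
  have h3 : (∑ x, ‖rhoA A ψ x x‖) ^ 2 ≤ (d:ℝ) ^ A.card * ∑ x, ‖rhoA A ψ x x‖ ^ 2 := by
    have := sq_sum_le_card_mul_sum_sq (s := (Finset.univ : Finset ((i : A) → Fin d)))
      (f := fun x => ‖rhoA A ψ x x‖)
    simpa using this
  have h4 : ∑ x, ‖rhoA A ψ x x‖ ^ 2 ≤ ∑ x, ∑ y, ‖rhoA A ψ x y‖ ^ 2 :=
    Finset.sum_le_sum fun x _ =>
      Finset.single_le_sum (f := fun y => ‖rhoA A ψ x y‖ ^ 2) (fun _ _ => by positivity) (Finset.mem_univ x)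
  rw [h1]
  calc _ ≤ (∑ x, ‖rhoA A ψ x x‖) ^ 2 := by
        gcongr
    _ ≤ _ := h3
    _ ≤ _ := by gcongr

end dens

section arith
variable (d D : ℕ)

lemma etaR_bounds (hd : 2 ≤ d) (hD : 2 ≤ D) : 0 ≤ etaR d D ∧ etaR d D ≤ 1 / d := by
  have hd' : (2:ℝ) ≤ d := by exact_mod_cast hd
  have hD' : (2:ℝ) ≤ D := by exact_mod_cast hD
  have h1 : (4:ℝ) ≤ d ^ 2 := by nlinarith
  have h2 : (4:ℝ) ≤ D ^ 2 := by nlinarith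
  have h3 : (0:ℝ) < d ^ 2 * D ^ 2 - 1 := by nlinarith
  unfold etaR
  constructor
  · apply div_nonneg _ h3.le
    nlinarith
  · rw [div_le_div_iff₀ h3 (by linarith)]
    nlinarith

lemma ovl_bound (hd : 2 ≤ d) (hD : 2 ≤ D) : 0 ≤ ovl d D ∧ ovl d D ≤ 9/4 * ((D:ℝ)^2)⁻¹ := by
  have hd' : (2:ℝ) ≤ d := by exact_mod_cast hd
  have hD' : (2:ℝ) ≤ D := by exact_mod_cast hD
  unfold ovl
  refine ⟨by positivity, ?_⟩
  have h : ((d:ℝ) + 1) * D / (d * D ^ 2 + 1) ≤ 3/2 * (D:ℝ)⁻¹ := by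
    rw [← div_eq_mul_inv, div_le_div_iff₀ (by positivity) (by positivity)]
    have : (0:ℝ) ≤ D^2 * (d - 2) := mul_nonneg (by positivity) (by linarith)
    nlinarith
  calc _ ≤ (3/2 * (D:ℝ)⁻¹) ^ 2 := by gcongr
    _ = _ := by rw [mul_pow, inv_pow]; norm_num

end arith
/-- almost maximum entropy for small connected subsystems.  For every
`d ≥ 2` and `0 < r < 2` there are constants `C, C' > 0` (depending only on `d` and
`r`) such that for all `D ≥ 2`, `l ≥ 1` and `n ≥ 2·log(D)/log(d) + l`, with `A`
the block of the first `l` sites, the normalized reduced state of the RMPS satisfies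
`Pr(Tr[(ρ'_A)²] ≥ C·D^{−r} + d^{−l}) ≤ C'·D^{−(2−r)}`.  The site unitaries are drawn
i.i.d. from the Haar probability measure on `U(dD)` (the unique left-invariant Borel
probability measure). -/
theorem almost_maximal_entropy
    (d : ℕ) [NeZero d] (hd : 2 ≤ d) (r : ℝ) (hr0 : 0 < r) (hr2 : r < 2) :
    ∃ C C' : ℝ, 0 < C ∧ 0 < C' ∧
      ∀ D l n : ℕ, 2 ≤ D → 1 ≤ l →
        2 * Real.log D / Real.log d + l ≤ (n : ℝ) →
      ∀ (μ : Measure (Matrix.unitaryGroup (Fin d × Fin D) ℂ)) [IsProbabilityMeasure μ],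
        (∀ V : Matrix.unitaryGroup (Fin d × Fin D) ℂ, μ.map (fun U => V * U) = μ) →
        (Measure.pi fun _ : Fin n => μ)
            {U | C * (D : ℝ) ^ (-r) + ((d : ℝ) ^ l)⁻¹ ≤
              (Matrix.trace
                ((((∑ x, ‖mps d D n U x‖ ^ 2 : ℝ) : ℂ))⁻¹ •
                    rhoA (Finset.univ.filter fun i : Fin n => (i : ℕ) < l) (mps d D n U) *
                  ((((∑ x, ‖mps d D n U x‖ ^ 2 : ℝ) : ℂ))⁻¹ •
                    rhoA (Finset.univ.filter fun i : Fin n => (i : ℕ) < l)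
                      (mps d D n U)))).re}
          ≤ ENNReal.ofReal (C' * (D : ℝ) ^ (-(2 - r))) := by
  refine ⟨1, 17, one_pos, by norm_num, ?_⟩
  intro D l n hD hl hn μ _ hμ
  have hd' : (2:ℝ) ≤ d := by exact_mod_cast hd
  have hD' : (2:ℝ) ≤ D := by exact_mod_cast hD
  have hlogd : 0 < Real.log d := Real.log_pos (by linarith)
  have hlogD : 0 < Real.log D := Real.log_pos (by linarith)
  have hln : l < n := by
    have : 0 < 2 * Real.log D / Real.log d := by positivity
    exact_mod_cast (by linarith : (l:ℝ) < n)
  obtain ⟨m, rfl⟩ : ∃ m, n = l + (m + 1) := ⟨n - l - 1, by omega⟩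
  have hpow : (D:ℝ) ^ 2 ≤ (d:ℝ) ^ (m+1) := by
    have h1 : 2 * Real.log D / Real.log d ≤ ((m+1 : ℕ) : ℝ) := by
      push_cast at hn ⊢; linarith
    rw [div_le_iff₀ hlogd] at h1
    rw [← Real.log_le_log_iff (by positivity) (by positivity), Real.log_pow, Real.log_pow]
    exact_mod_cast h1
  obtain ⟨he0, he1⟩ := etaR_bounds d D hd hD
  obtain ⟨ho0, ho1⟩ := ovl_bound d D hd hD
  have hd1 : (1:ℝ) / d ≤ 1 := by rw [div_le_one (by linarith)]; linarith
  have heta1 : etaR d D ≤ 1 := he1.trans hd1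
  have hem : etaR d D ^ (m+1) ≤ ((D:ℝ)^2)⁻¹ := by
    calc etaR d D ^ (m+1) ≤ (1 / (d:ℝ)) ^ (m+1) := by gcongr
      _ = ((d:ℝ) ^ (m+1))⁻¹ := by rw [one_div, inv_pow]
      _ ≤ _ := by gcongr
  have hel : etaR d D ^ l ≤ ((d:ℝ)^l)⁻¹ := by
    calc etaR d D ^ l ≤ (1 / (d:ℝ)) ^ l := by gcongr
      _ = _ := by rw [one_div, inv_pow]
  have hel1 : etaR d D ^ l ≤ 1 := pow_le_one₀ he0 heta1
  have hem1 : etaR d D ^ (m+1) ≤ 1 := pow_le_one₀ he0 heta1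
  have hel0 : 0 ≤ etaR d D ^ l := pow_nonneg he0 _
  have hem0 : 0 ≤ etaR d D ^ (m+1) := pow_nonneg he0 _
  set A : Finset (Fin (l + (m+1))) := Finset.univ.filter fun i => (i : ℕ) < l with hA
  have hAcard : A.card = l := by
    rw [hA, Fin.card_filter_val_lt]; omega
  set P := Measure.pi fun _ : Fin (l + (m+1)) => μ with hP
  let N : (Fin (l + (m+1)) → Matrix.unitaryGroup (Fin d × Fin D) ℂ) → ℝ := fun U =>
    ∑ x, ‖mps d D (l + (m+1)) U x‖ ^ 2
  let X : (Fin (l + (m+1)) → Matrix.unitaryGroup (Fin d × Fin D) ℂ) → ℝ := fun U =>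
    (Matrix.trace (rhoA A (mps d D (l + (m+1)) U) * rhoA A (mps d D (l + (m+1)) U))).re
  -- first moment of the norm
  have hN1 : Integrable N P ∧ ∫ U, N U ∂P = 1 := by
    obtain ⟨a, b⟩ := integral_norm d D μ hμ hd hD (l + (m+1)) (by omega)
    simp only [norm_eq] at a b
    refine ⟨a.re, ?_⟩
    have := b
    rw [integral_complex_ofReal] at this
    exact_mod_cast this
  have hN2 : Integrable (fun U => N U ^ 2) P ∧
      ∫ U, N U ^ 2 ∂P = expF d D 0 (l + (m+1)) := by
    obtain ⟨a, b⟩ := integral_repF d D μ hμ hd hD (l + (m+1)) 0 (l + m) (by omega)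
    simp only [repF_zero] at a b
    refine ⟨a.re, ?_⟩
    have := b
    rw [integral_complex_ofReal] at this
    exact_mod_cast this
  have hX : Integrable X P ∧ ∫ U, X U ∂P = expF d D l (m+1) := by
    obtain ⟨a, b⟩ := integral_repF d D μ hμ hd hD (l + (m+1)) l m rfl
    have e : ∀ U, X U = (repF d (fun k : Fin (l + (m+1)) => decide ((k:ℕ) < l))
        (mps d D (l + (m+1)) U)).re := by
      intro U
      simp only [X]
      rw [trace_rho_sq]
      simp [hA]
    have e' : X = fun U => (repF d (fun k : Fin (l + (m+1)) => decide ((k:ℕ) < l))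
        (mps d D (l + (m+1)) U)).re := funext e
    rw [e']
    refine ⟨a.re, ?_⟩
    have h := integral_re a
    refine h.trans ?_
    rw [b]
    simp
  -- variance
  have hV : Integrable (fun U => (N U - 1) ^ 2) P ∧ ∫ U, (N U - 1) ^ 2 ∂P ≤ ((D:ℝ)^2)⁻¹ := by
    have e : (fun U => (N U - 1) ^ 2) = fun U => (N U ^ 2 - 2 * N U) + 1 := by
      funext U; ring
    have i1 : Integrable (fun U => N U ^ 2 - 2 * N U) P := hN2.1.sub (hN1.1.const_mul 2)
    rw [e]
    refine ⟨i1.add (integrable_const _), ?_⟩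
    rw [integral_add i1 (integrable_const _), integral_sub hN2.1 (hN1.1.const_mul 2),
      integral_const_mul, hN1.2, hN2.2]
    have : etaR d D ^ (l + (m+1)) ≤ etaR d D ^ (m+1) := pow_le_pow_of_le_one he0 heta1 (by omega)
    simp [expF]
    linarith
  let Y : (Fin (l + (m+1)) → Matrix.unitaryGroup (Fin d × Fin D) ℂ) → ℝ := fun U =>
    X U - ((d:ℝ)^l)⁻¹ * N U ^ 2
  have hdl : (0:ℝ) < (d:ℝ)^l := by positivity
  have hY0 : ∀ U, 0 ≤ Y U := by
    intro U
    have := purity_ge A (mps d D (l + (m+1)) U)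
    rw [hAcard] at this
    simp only [Y]
    rw [sub_nonneg, inv_mul_le_iff₀ hdl]
    exact this
  have hY : Integrable Y P ∧ ∫ U, Y U ∂P ≤ 13/4 * ((D:ℝ)^2)⁻¹ := by
    refine ⟨hX.1.sub (hN2.1.const_mul _), ?_⟩
    simp only [Y]
    rw [integral_sub hX.1 (hN2.1.const_mul _), integral_const_mul, hX.2, hN2.2]
    have hln0 : 0 ≤ etaR d D ^ (l + (m+1)) := pow_nonneg he0 _
    have h0 : expF d D 0 (l + (m+1)) = 1 + etaR d D ^ (l + (m+1)) := by simp [expF]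
    have h1 : (1 - etaR d D ^ l) * (1 - etaR d D ^ (m+1)) * ovl d D ≤ ovl d D := by
      refine mul_le_of_le_one_left ho0 ?_
      exact mul_le_one₀ (by linarith) (by linarith) (by linarith)
    have h2 : 0 ≤ ((d:ℝ)^l)⁻¹ * etaR d D ^ (l + (m+1)) := by positivity
    rw [h0, expF]
    linarith
  have hDr : (0:ℝ) < (D:ℝ) ^ (-r) := by positivity
  have m1 := mul_meas_ge_le_integral_of_nonneg (μ := P) (f := fun U => (N U - 1) ^ 2)
    (Filter.Eventually.of_forall fun U => by positivity) hV.1 (1/4)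
  have m2 := mul_meas_ge_le_integral_of_nonneg (μ := P) (f := Y)
    (Filter.Eventually.of_forall hY0) hY.1 ((D:ℝ) ^ (-r) / 4)
  have hsub : {U | 1 * (D : ℝ) ^ (-r) + ((d : ℝ) ^ l)⁻¹ ≤
              (Matrix.trace
                ((((∑ x, ‖mps d D (l + (m+1)) U x‖ ^ 2 : ℝ) : ℂ))⁻¹ •
                    rhoA A (mps d D (l + (m+1)) U) *
                  ((((∑ x, ‖mps d D (l + (m+1)) U x‖ ^ 2 : ℝ) : ℂ))⁻¹ •
                    rhoA A (mps d D (l + (m+1)) U)))).re} ⊆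
      {U | 1/4 ≤ (N U - 1) ^ 2} ∪ {U | (D:ℝ) ^ (-r) / 4 ≤ Y U} := by
    intro U hU
    have e : (Matrix.trace
                ((((∑ x, ‖mps d D (l + (m+1)) U x‖ ^ 2 : ℝ) : ℂ))⁻¹ •
                    rhoA A (mps d D (l + (m+1)) U) *
                  ((((∑ x, ‖mps d D (l + (m+1)) U x‖ ^ 2 : ℝ) : ℂ))⁻¹ •
                    rhoA A (mps d D (l + (m+1)) U)))).re = (N U)⁻¹ * ((N U)⁻¹ * X U) := by
      simp only [smul_mul_assoc, mul_smul_comm, Matrix.trace_smul, smul_eq_mul, ← Complex.ofReal_inv,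
        Complex.re_ofReal_mul, N, X]
    rw [Set.mem_setOf_eq, e, one_mul] at hU
    by_cases h : N U < 1/2
    · left
      rw [Set.mem_setOf_eq]
      nlinarith
    · right
      rw [Set.mem_setOf_eq]
      push Not at h
      have hNp : 0 < N U := by linarith
      have h1 : ((D:ℝ) ^ (-r) + ((d:ℝ)^l)⁻¹) * N U ^ 2 ≤ X U := by
        have := mul_le_mul_of_nonneg_right hU (sq_nonneg (N U))
        refine this.trans (le_of_eq ?_)
        field_simp
      have h2 : (D:ℝ) ^ (-r) * (1/4) ≤ (D:ℝ) ^ (-r) * N U ^ 2 := by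
        gcongr
        nlinarith
      simp only [Y]
      linarith
  refine (measure_mono hsub).trans ((measure_union_le _ _).trans ?_)
  rw [← ofReal_measureReal (measure_ne_top P _), ← ofReal_measureReal (measure_ne_top P _),
    ← ENNReal.ofReal_add measureReal_nonneg measureReal_nonneg]
  apply ENNReal.ofReal_le_ofReal
  have hexp : (D:ℝ) ^ (-(2 - r)) = ((D:ℝ)^2)⁻¹ * ((D:ℝ) ^ (-r))⁻¹ := by
    rw [← Real.rpow_neg (by positivity), ← Real.rpow_natCast, ← Real.rpow_neg (by positivity),
      ← Real.rpow_add (by positivity)]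
    congr 1
    push_cast; ring
  have hr1 : (D:ℝ) ^ (-r) ≤ 1 := Real.rpow_le_one_of_one_le_of_nonpos (by linarith) (by linarith)
  have hinv : 1 ≤ ((D:ℝ) ^ (-r))⁻¹ := (one_le_inv₀ hDr).2 hr1
  have hq : (0:ℝ) < ((D:ℝ)^2)⁻¹ := by positivity
  have b1 : P.real {U | 1/4 ≤ (N U - 1) ^ 2} ≤ 4 * (((D:ℝ)^2)⁻¹ * ((D:ℝ) ^ (-r))⁻¹) := by
    have : ((D:ℝ)^2)⁻¹ ≤ ((D:ℝ)^2)⁻¹ * ((D:ℝ) ^ (-r))⁻¹ := le_mul_of_one_le_right hq.le hinv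
    linarith [m1.trans hV.2]
  have b2 : P.real {U | (D:ℝ) ^ (-r) / 4 ≤ Y U} ≤ 13 * (((D:ℝ)^2)⁻¹ * ((D:ℝ) ^ (-r))⁻¹) := by
    have h := m2.trans hY.2
    rw [← mul_assoc, ← div_eq_mul_inv _ ((D:ℝ) ^ (-r)), le_div_iff₀ hDr]
    linarith
  rw [hexp]
  linarith
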